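/- Let W be a real random variable following the Gamma distribution G(a, b) with shape a > 0 and scale b > 0. Then E[Q(√W)] = (1/(2√(2π))) · (√b · Γ(a + 1/2)) / ((1 + b/2)^{a + 1/2} · Γ(a + 1)) · Σ_{n=0}^∞ [ (1)_n (a + 1/2)_n / (a + 1)_n ] · (2/(2 + b))^n / n!. -/

import Mathlib

open MeasureTheory ProbabilityTheory

/-- The density of the Gamma distribution `G(a, b)` with shape `a` and scale `b`:
`f(x) = x^(a-1) e^(-x/b) / (b^a Γ(a))` for `x > 0` and `0` for `x ≤ 0`. -/
noncomputable def gammaPdf (a b x : ℝ) : ℝ :=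
  if 0 < x then x ^ (a - 1) * Real.exp (-x / b) / (b ^ a * Real.Gamma a) else 0

/-- A real random variable `X` on `(α, μ)` follows the Gamma distribution `G(a, b)`:
its law has density `gammaPdf a b` with respect to Lebesgue measure. -/
def HasGammaLaw {α : Type*} [MeasurableSpace α] (μ : Measure α) (X : α → ℝ) (a b : ℝ) : Prop :=
  Measure.map X μ = volume.withDensity (fun x => ENNReal.ofReal (gammaPdf a b x))


/-- The rising factorial (Pochhammer symbol) `(q)_n = q (q+1) ⋯ (q+n−1)`, with `(q)_0 = 1`. -/
noncomputable def risingFactorial (q : ℝ) (n : ℕ) : ℝ :=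
  ∏ i ∈ Finset.range n, (q + i)

/-- The Gaussian Q-function: `Q(x) = ∫_x^∞ (1/√(2π)) e^(−t²/2) dt`. -/
noncomputable def gaussQ (x : ℝ) : ℝ :=
  ∫ t in Set.Ioi x, (1 / Real.sqrt (2 * Real.pi)) * Real.exp (-t ^ 2 / 2)

open Filter Topology Set

theorem risingFactorial_mul_Gamma {q : ℝ} (hq : 0 < q) (n : ℕ) :
    risingFactorial q n * Real.Gamma q = Real.Gamma (q + n) := by
  induction n with
  | zero => simp [risingFactorial]
  | succ n ih =>
    have hne : q + n ≠ 0 := by positivity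
    rw [Nat.cast_succ, ← add_assoc, Real.Gamma_add_one hne, ← ih, risingFactorial,
      Finset.prod_range_succ, ← risingFactorial]
    ring

theorem risingFactorial_one (n : ℕ) : risingFactorial 1 n = (Nat.factorial n : ℝ) := by
  have h := risingFactorial_mul_Gamma one_pos n
  rwa [Real.Gamma_one, mul_one, add_comm, Real.Gamma_nat_eq_factorial] at h

theorem integrable_gaussQ_integrand :
    Integrable fun t : ℝ => (1 / Real.sqrt (2 * Real.pi)) * Real.exp (-t ^ 2 / 2) := by
  refine ((integrable_exp_neg_mul_sq (b := 1 / 2) (by norm_num)).const_mul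
    (1 / Real.sqrt (2 * Real.pi))).congr
    (ae_of_all _ fun t => ?_)
  dsimp only
  congr 2
  ring

theorem hasDerivAt_gaussQ (x : ℝ) :
    HasDerivAt gaussQ (-((1 / Real.sqrt (2 * Real.pi)) * Real.exp (-x ^ 2 / 2))) x := by
  have hcont : Continuous fun t : ℝ =>
      (1 / Real.sqrt (2 * Real.pi)) * Real.exp (-t ^ 2 / 2) := by fun_prop
  have hd := (intervalIntegral.integral_hasDerivAt_right
    (hcont.intervalIntegrable 0 x) hcont.stronglyMeasurable.stronglyMeasurableAtFilter
    hcont.continuousAt).const_sub (gaussQ 0)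
  refine hd.congr_of_eventuallyEq (Eventually.of_forall fun y => ?_)
  have := intervalIntegral.integral_Ioi_sub_Ioi' (a := 0) (b := y)
    integrable_gaussQ_integrand.integrableOn integrable_gaussQ_integrand.integrableOn
  simp only [gaussQ]
  linarith

theorem continuous_gaussQ : Continuous gaussQ :=
  continuous_iff_continuousAt.2 fun x => (hasDerivAt_gaussQ x).continuousAt

theorem gaussQ_nonneg (x : ℝ) : 0 ≤ gaussQ x :=
  integral_nonneg fun _ => by positivity

theorem norm_gaussQ_le (x : ℝ) :
    ‖gaussQ x‖ ≤ ∫ t : ℝ, (1 / Real.sqrt (2 * Real.pi)) * Real.exp (-t ^ 2 / 2) := by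
  rw [Real.norm_of_nonneg (gaussQ_nonneg x)]
  exact setIntegral_le_integral integrable_gaussQ_integrand (ae_of_all _ fun _ => by positivity)

theorem exists_gaussQ_sqrt_le :
    ∃ C, ∀ w : ℝ, 0 < w → gaussQ (Real.sqrt w) ≤ C * Real.exp (-w / 4) := by
  have hint : Integrable fun t : ℝ =>
      (1 / Real.sqrt (2 * Real.pi)) * Real.exp (-(1 / 4) * t ^ 2) :=
    (integrable_exp_neg_mul_sq (by norm_num)).const_mul _
  refine ⟨∫ t : ℝ, (1 / Real.sqrt (2 * Real.pi)) * Real.exp (-(1 / 4) * t ^ 2),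
    fun w hw => ?_⟩
  rw [← integral_mul_const]
  refine le_trans ?_ (setIntegral_le_integral (s := Ioi (Real.sqrt w)) (hint.mul_const _)
    (ae_of_all _ fun _ => by positivity))
  refine setIntegral_mono_on integrable_gaussQ_integrand.integrableOn
    (hint.mul_const _).integrableOn measurableSet_Ioi fun t ht => ?_
  rw [mul_assoc, ← Real.exp_add]
  have hle : w ≤ t ^ 2 := by
    rw [← Real.sq_sqrt hw.le]
    exact pow_le_pow_left₀ (Real.sqrt_nonneg _) (le_of_lt ht) 2
  gcongr
  linarith

theorem hasDerivAt_gaussQ_sqrt {w : ℝ} (hw : 0 < w) :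
    HasDerivAt (fun w => gaussQ (Real.sqrt w))
      (-((1 / (2 * Real.sqrt (2 * Real.pi))) * w ^ (-(1 / 2) : ℝ) * Real.exp (-w / 2))) w := by
  refine ((hasDerivAt_gaussQ _).comp w (Real.hasDerivAt_sqrt hw.ne')).congr_deriv ?_
  rw [Real.sq_sqrt hw.le, Real.rpow_neg hw.le, ← Real.sqrt_eq_rpow]
  have := (Real.sqrt_pos.2 hw).ne'
  have := (Real.sqrt_pos.2 Real.two_pi_pos).ne'
  field_simp

theorem gammaPdf_of_pos (a b : ℝ) {w : ℝ} (hw : 0 < w) :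
    gammaPdf a b w = w ^ (a - 1) * Real.exp (-w / b) / (b ^ a * Real.Gamma a) :=
  if_pos hw

theorem gammaPdf_nonneg {a b : ℝ} (ha : 0 < a) (hb : 0 < b) (w : ℝ) : 0 ≤ gammaPdf a b w := by
  unfold gammaPdf
  split_ifs
  · positivity
  · exact le_rfl

theorem integrableOn_rpow_mul_exp_neg_mul {s r : ℝ} (hs : -1 < s) (hr : 0 < r) :
    IntegrableOn (fun w : ℝ => w ^ s * Real.exp (-r * w)) (Ioi 0) := by
  simpa using integrableOn_rpow_mul_exp_neg_mul_rpow hs one_pos hr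

theorem integrableOn_gammaPdf {a b : ℝ} (ha : 0 < a) (hb : 0 < b) :
    IntegrableOn (gammaPdf a b) (Ioi 0) := by
  refine IntegrableOn.congr_fun ((integrableOn_rpow_mul_exp_neg_mul (s := a - 1) (r := 1 / b)
    (by linarith) (by positivity)).div_const (b ^ a * Real.Gamma a)) (fun w hw => ?_)
    measurableSet_Ioi
  rw [gammaPdf_of_pos a b hw]
  congr 3
  ring

theorem integrableOn_gaussQ_sqrt_mul_gammaPdf {a b : ℝ} (ha : 0 < a) (hb : 0 < b) :
    IntegrableOn (fun w => gaussQ (Real.sqrt w) * gammaPdf a b w) (Ioi 0) :=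
  Integrable.bdd_mul (integrableOn_gammaPdf ha hb)
    (continuous_gaussQ.comp Real.continuous_sqrt).aestronglyMeasurable
    (ae_of_all _ fun _ => norm_gaussQ_le _)

/-- The antiderivative of `gammaPdf a b - gammaPdf (a + 1) b` on the positive half-line. -/
theorem hasDerivAt_rpow_mul_exp_div_Gamma {a b : ℝ} (ha : 0 < a) (hb : 0 < b) {w : ℝ}
    (hw : 0 < w) :
    HasDerivAt (fun w : ℝ => w ^ a * Real.exp (-(1 / b) * w) / (b ^ a * Real.Gamma (a + 1)))
      (gammaPdf a b w - gammaPdf (a + 1) b w) w := by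
  have h1 := Real.hasDerivAt_rpow_const (x := w) (p := a) (Or.inl hw.ne')
  have h2 := ((hasDerivAt_id w).const_mul (-(1 / b))).exp
  refine ((h1.mul h2).div_const _).congr_deriv ?_
  have hG := (Real.Gamma_pos_of_pos ha).ne'
  have hba := (Real.rpow_pos_of_pos hb a).ne'
  have he : -(1 / b) * w = -w / b := by ring
  rw [gammaPdf_of_pos a b hw, gammaPdf_of_pos (a + 1) b hw, add_sub_cancel_right,
    Real.Gamma_add_one ha.ne', Real.rpow_add_one hb.ne', id, he]
  field_simp
  ring

/-- Integration by parts relates the expectations for the shapes `a` and `a + 1`. -/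
theorem integral_gaussQ_sqrt_mul_gammaPdf_sub {a b : ℝ} (ha : 0 < a) (hb : 0 < b) :
    (∫ w in Ioi 0, gaussQ (Real.sqrt w) * gammaPdf a b w) -
        ∫ w in Ioi 0, gaussQ (Real.sqrt w) * gammaPdf (a + 1) b w =
      (1 / (2 * Real.sqrt (2 * Real.pi))) * (Real.sqrt b * Real.Gamma (a + 1 / 2)) /
        ((1 + b / 2) ^ (a + 1 / 2) * Real.Gamma (a + 1)) := by
  set K := (1 / (2 * Real.sqrt (2 * Real.pi))) / (b ^ a * Real.Gamma (a + 1)) with hK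
  have hr : 0 < 1 / b + 1 / 2 := by positivity
  have hint := integrableOn_gaussQ_sqrt_mul_gammaPdf ha hb
  have hint' := integrableOn_gaussQ_sqrt_mul_gammaPdf (a := a + 1) (by linarith) hb
  have hprod : ∀ w ∈ Ioi (0 : ℝ),
      -((1 / (2 * Real.sqrt (2 * Real.pi))) * w ^ (-(1 / 2) : ℝ) * Real.exp (-w / 2)) *
        (w ^ a * Real.exp (-(1 / b) * w) / (b ^ a * Real.Gamma (a + 1))) =
      -K * (w ^ (a - 1 / 2) * Real.exp (-(1 / b + 1 / 2) * w)) := by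
    intro w hw
    rw [show a - 1 / 2 = -(1 / 2) + a by ring, Real.rpow_add hw,
      show -(1 / b + 1 / 2) * w = -w / 2 + -(1 / b) * w by ring, Real.exp_add, hK]
    ring
  have hlim : ∀ l : Filter ℝ, Tendsto (fun w : ℝ => w ^ a * Real.exp (-(1 / b) * w)) l (𝓝 0) →
      Tendsto ((fun w => gaussQ (Real.sqrt w)) * fun w : ℝ =>
        w ^ a * Real.exp (-(1 / b) * w) / (b ^ a * Real.Gamma (a + 1))) l (𝓝 0) := by
    intro l ht
    have h0 := ht.div_const (b ^ a * Real.Gamma (a + 1))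
    rw [zero_div] at h0
    rw [mul_comm]
    exact h0.zero_mul_isBoundedUnder_le
      ⟨_, eventually_map.2 (Eventually.of_forall fun _ => norm_gaussQ_le _)⟩
  have hparts := integral_Ioi_mul_deriv_eq_deriv_mul (a := (0 : ℝ)) (a' := (0 : ℝ)) (b' := (0 : ℝ))
    (u := fun w => gaussQ (Real.sqrt w))
    (v := fun w : ℝ => w ^ a * Real.exp (-(1 / b) * w) / (b ^ a * Real.Gamma (a + 1)))
    (fun w hw => hasDerivAt_gaussQ_sqrt hw)
    (fun w hw => hasDerivAt_rpow_mul_exp_div_Gamma ha hb hw)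
    (by
      refine (hint.sub hint').congr_fun (fun w _ => ?_) measurableSet_Ioi
      simp [mul_sub])
    (IntegrableOn.congr_fun
      ((integrableOn_rpow_mul_exp_neg_mul (s := a - 1 / 2) (by linarith) hr).const_mul (-K))
      (fun w hw => (hprod w hw).symm) measurableSet_Ioi)
    (hlim _ (by
      have : ContinuousAt (fun w : ℝ => w ^ a * Real.exp (-(1 / b) * w)) 0 :=
        (Real.continuousAt_rpow_const _ _ (Or.inr ha.le)).mul (by fun_prop)
      have := this.tendsto.mono_left (nhdsWithin_le_nhds (s := Ioi 0))
      simpa [Real.zero_rpow ha.ne'] using this))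
    (hlim _ (tendsto_rpow_mul_exp_neg_mul_atTop_nhds_zero a (1 / b) (by positivity)))
  rw [← integral_sub hint hint']
  simp_rw [← mul_sub]
  rw [hparts, setIntegral_congr_fun measurableSet_Ioi hprod, integral_const_mul]
  have hI := Real.integral_rpow_mul_exp_neg_mul_Ioi (a := a + 1 / 2) (by linarith) hr
  rw [show a + 1 / 2 - 1 = a - 1 / 2 by ring] at hI
  simp_rw [← neg_mul] at hI
  have hb2 : 1 / (1 / b + 1 / 2) = b / (1 + b / 2) := by field_simp
  rw [hI, hb2, Real.div_rpow hb.le (by positivity), Real.rpow_add hb, ← Real.sqrt_eq_rpow, hK]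
  have hba := (Real.rpow_pos_of_pos hb a).ne'
  field_simp
  ring

theorem tendsto_integral_gaussQ_sqrt_mul_gammaPdf {a b : ℝ} (ha : 0 < a) (hb : 0 < b) :
    Tendsto (fun n : ℕ => ∫ w in Ioi 0, gaussQ (Real.sqrt w) * gammaPdf (a + n) b w)
      atTop (𝓝 0) := by
  obtain ⟨C, hle⟩ := exists_gaussQ_sqrt_le
  have hr : 0 < 1 / b + 1 / 4 := by positivity
  have hbound : ∀ n : ℕ, ∫ w in Ioi 0, gaussQ (Real.sqrt w) * gammaPdf (a + n) b w ≤
      C * ((1 + b / 4)⁻¹ ^ a * (1 + b / 4)⁻¹ ^ n) := by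
    intro n
    have hA : 0 < a + n := by positivity
    have hI := Real.integral_rpow_mul_exp_neg_mul_Ioi hA hr
    simp_rw [← neg_mul] at hI
    have hG := (Real.Gamma_pos_of_pos hA).ne'
    have hbA := (Real.rpow_pos_of_pos hb (a + n)).ne'
    calc _ ≤ ∫ w in Ioi 0, C / (b ^ (a + n) * Real.Gamma (a + n)) *
          (w ^ (a + n - 1) * Real.exp (-(1 / b + 1 / 4) * w)) := by
          refine setIntegral_mono_on (integrableOn_gaussQ_sqrt_mul_gammaPdf hA hb)
            ((integrableOn_rpow_mul_exp_neg_mul (by linarith) hr).const_mul _)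
            measurableSet_Ioi fun w hw => ?_
          refine (mul_le_mul_of_nonneg_right (hle w hw) (gammaPdf_nonneg hA hb w)).trans_eq ?_
          rw [gammaPdf_of_pos _ b hw,
            show -(1 / b + 1 / 4) * w = -w / 4 + -w / b by ring, Real.exp_add]
          ring
      _ = _ := by
          have hb4 : 1 / (1 / b + 1 / 4) = b * (1 + b / 4)⁻¹ := by field_simp
          rw [integral_const_mul, hI, hb4, Real.mul_rpow hb.le (by positivity),
            Real.rpow_add (x := (1 + b / 4)⁻¹) (by positivity), Real.rpow_natCast]
          field_simp
  have hlim : Tendsto (fun n : ℕ => C * ((1 + b / 4)⁻¹ ^ a * (1 + b / 4)⁻¹ ^ n)) atTop (𝓝 0) := by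
    have := tendsto_pow_atTop_nhds_zero_of_lt_one (r := (1 + b / 4)⁻¹) (by positivity)
      (inv_lt_one_of_one_lt₀ (by linarith))
    simpa using (this.const_mul ((1 + b / 4)⁻¹ ^ a)).const_mul C
  refine squeeze_zero (fun n => ?_) hbound hlim
  exact integral_nonneg fun w =>
    mul_nonneg (gaussQ_nonneg _) (gammaPdf_nonneg (by positivity) hb w)

theorem hasSum_integral_gaussQ_sqrt_mul_gammaPdf {a b : ℝ} (ha : 0 < a) (hb : 0 < b) :
    HasSum (fun n : ℕ => (1 / (2 * Real.sqrt (2 * Real.pi))) *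
        (Real.sqrt b * Real.Gamma (a + n + 1 / 2)) /
          ((1 + b / 2) ^ (a + n + 1 / 2) * Real.Gamma (a + n + 1)))
      (∫ w in Ioi 0, gaussQ (Real.sqrt w) * gammaPdf a b w) := by
  rw [hasSum_iff_tendsto_nat_of_nonneg (fun n => by positivity)]
  have hstep : ∀ n : ℕ, _ :=
    fun n => integral_gaussQ_sqrt_mul_gammaPdf_sub (a := a + n) (by positivity) hb
  simp_rw [← hstep, add_assoc, ← Nat.cast_succ]
  simp_rw [Finset.sum_range_sub'
    (fun n : ℕ => ∫ w in Ioi 0, gaussQ (Real.sqrt w) * gammaPdf (a + n) b w)]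
  simpa using (tendsto_integral_gaussQ_sqrt_mul_gammaPdf ha hb).const_sub
    (∫ w in Ioi 0, gaussQ (Real.sqrt w) * gammaPdf a b w)

theorem measurable_gammaPdf (a b : ℝ) : Measurable (gammaPdf a b) :=
  Measurable.ite measurableSet_Ioi (by fun_prop) measurable_const

theorem HasGammaLaw.integral_comp {α : Type*} [MeasurableSpace α] {μ : Measure α} {W : α → ℝ}
    {a b : ℝ} (ha : 0 < a) (hb : 0 < b) (hmeas : Measurable W) (hW : HasGammaLaw μ W a b)
    {f : ℝ → ℝ} (hf : Measurable f) :
    ∫ ω, f (W ω) ∂μ = ∫ w in Ioi 0, f w * gammaPdf a b w := by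
  rw [← integral_map hmeas.aemeasurable hf.aestronglyMeasurable, hW,
    integral_withDensity_eq_integral_toReal_smul (measurable_gammaPdf a b).ennreal_ofReal
      (ae_of_all _ fun _ => ENNReal.ofReal_lt_top), ← integral_indicator measurableSet_Ioi]
  refine integral_congr_ae (ae_of_all _ fun w => ?_)
  dsimp only
  rw [ENNReal.toReal_ofReal (gammaPdf_nonneg ha hb w), smul_eq_mul, mul_comm]
  by_cases hw : 0 < w <;> simp [hw, gammaPdf]

/-- Closed form for `E[Q(√W)]` when `W ~ G(a, b)`, in terms of the Gauss hypergeometric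
series `₂F₁(1, a + 1/2; a + 1; 2/(2 + b))`. -/
theorem expectation_gaussQ_sqrt_gamma_closed_form
    {α : Type*} [MeasurableSpace α] (μ : Measure α) [IsProbabilityMeasure μ]
    (W : α → ℝ) (a b : ℝ) (ha : 0 < a) (hb : 0 < b)
    (hmeas : Measurable W)
    (hW : HasGammaLaw μ W a b) :
    ∫ ω, gaussQ (Real.sqrt (W ω)) ∂μ =
      (1 / (2 * Real.sqrt (2 * Real.pi))) *
        (Real.sqrt b * Real.Gamma (a + 1 / 2)) /
          ((1 + b / 2) ^ (a + 1 / 2) * Real.Gamma (a + 1)) *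
        ∑' n : ℕ,
          risingFactorial 1 n * risingFactorial (a + 1 / 2) n / risingFactorial (a + 1) n *
            (2 / (2 + b)) ^ n / (Nat.factorial n : ℝ) := by
  rw [hW.integral_comp ha hb hmeas
      (f := fun w => gaussQ (Real.sqrt w)) (continuous_gaussQ.comp Real.continuous_sqrt).measurable,
    ← (hasSum_integral_gaussQ_sqrt_mul_gammaPdf ha hb).tsum_eq, ← tsum_mul_left]
  refine tsum_congr fun n => ?_
  have h1 := risingFactorial_mul_Gamma (q := a + 1 / 2) (by linarith) n
  have h2 := risingFactorial_mul_Gamma (q := a + 1) (by linarith) n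
  have hpos : 0 < risingFactorial (a + 1) n := Finset.prod_pos fun i _ => by positivity
  have hx : 2 / (2 + b) = (1 + b / 2)⁻¹ := by field_simp
  rw [risingFactorial_one, add_right_comm a n (1 / 2), add_right_comm a n 1, ← h1, ← h2,
    Real.rpow_add (y := a + 1 / 2) (by positivity), Real.rpow_natCast, hx, inv_pow]
  have := (Real.Gamma_pos_of_pos (show 0 < a + 1 by linarith)).ne'
  have := (Real.sqrt_pos.2 Real.two_pi_pos).ne'
  have : (Nat.factorial n : ℝ) ≠ 0 := by positivity
  have : (1 + b / 2) ^ (a + 1 / 2) ≠ 0 := by positivity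
  have : (1 + b / 2) ≠ 0 := by positivity
  generalize 1 + b / 2 = c at *
  generalize c ^ (a + 1 / 2) = d at *
  field_simp
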